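/- Suppose L : U → ΛGL_{n}(C) is smooth with Ω^h := L^{-1}dL of the form Ω^h = (1/h)ω + θ⁽⁰⁾ + hθ⁽¹⁾ + ⋯ + h^pθ⁽ᵖ⁾ (finitely many non-negative powers of h, one pole term). If L = L₋L₊ is a Birkhoff factorization, where L₋ = I + h^{-1}A₁ + h^{-2}A₂ + ⋯ extends to |h| > 1 with L₋(∞) = I and L₊ = Q₀(I + hQ₁ + h²Q₂ + ⋯) extends to |h| < 1, then L₋^{-1}dL₋ = (1/h) Q₀ ω Q₀^{-1}; in particular L₋^{-1}dL₋ has only the coefficient of h^{-1} nonzero. -/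

import Mathlib

/-- Partial derivative (in the direction tᵢ, with ∂ᵢ = ∂/∂tᵢ) of a matrix-valued
function of (t, h), taken entrywise. -/
noncomputable def pdh {r n : ℕ} (F : (Fin r → ℂ) → ℂ → Matrix (Fin n) (Fin n) ℂ)
    (i : Fin r) (t : Fin r → ℂ) (h : ℂ) : Matrix (Fin n) (Fin n) ℂ :=
  Matrix.of fun k l => fderiv ℂ (fun x => F x h k l) t (Pi.single i 1)

/-- Partial derivative of a matrix-valued function of t, taken entrywise. -/
noncomputable def pdm {r n : ℕ} (F : (Fin r → ℂ) → Matrix (Fin n) (Fin n) ℂ)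
    (i : Fin r) (t : Fin r → ℂ) : Matrix (Fin n) (Fin n) ℂ :=
  Matrix.of fun k l => fderiv ℂ (fun x => F x k l) t (Pi.single i 1)

open Metric Filter Topology

/-- The disc algebra, as functions on `ℂ`. -/
def DiscAlg : Subalgebra ℂ (ℂ → ℂ) where
  carrier := {f | DifferentiableOn ℂ f (ball 0 1) ∧ ContinuousOn f (closedBall 0 1)}
  mul_mem' := fun ha hb => ⟨ha.1.mul hb.1, ha.2.mul hb.2⟩
  add_mem' := fun ha hb => ⟨ha.1.add hb.1, ha.2.add hb.2⟩
  algebraMap_mem' := fun c => ⟨differentiableOn_const c, continuousOn_const⟩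

/-- Functions continuous at zero. -/
def ContAlg : Subalgebra ℂ (ℂ → ℂ) where
  carrier := {f | ContinuousAt f 0}
  mul_mem' := fun ha hb => ContinuousAt.mul ha hb
  add_mem' := fun ha hb => ContinuousAt.add ha hb
  algebraMap_mem' := fun _ => continuousAt_const

lemma const_mem_alg (S : Subalgebra ℂ (ℂ → ℂ)) (c : ℂ) : (fun _ => c) ∈ S :=
  S.algebraMap_mem c

lemma sum_mem_alg (S : Subalgebra ℂ (ℂ → ℂ)) {ι : Type*} (s : Finset ι) (f : ι → ℂ → ℂ)
    (hf : ∀ i ∈ s, f i ∈ S) : (fun z => ∑ i ∈ s, f i z) ∈ S := by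
  have := sum_mem hf
  convert this using 1
  ext z; simp

lemma prod_mem_alg (S : Subalgebra ℂ (ℂ → ℂ)) {ι : Type*} (s : Finset ι) (f : ι → ℂ → ℂ)
    (hf : ∀ i ∈ s, f i ∈ S) : (fun z => ∏ i ∈ s, f i z) ∈ S := by
  have := prod_mem hf
  convert this using 1
  ext z; simp

lemma det_mem_alg (S : Subalgebra ℂ (ℂ → ℂ)) {n : ℕ} (M : ℂ → Matrix (Fin n) (Fin n) ℂ)
    (hM : ∀ k l, (fun z => M z k l) ∈ S) : (fun z => (M z).det) ∈ S := by
  simp only [Matrix.det_apply']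
  refine sum_mem_alg S _ _ fun σ _ => ?_
  exact S.mul_mem (const_mem_alg S _) (prod_mem_alg S _ _ fun i _ => hM _ _)

lemma mul_mem_alg (S : Subalgebra ℂ (ℂ → ℂ)) {n : ℕ} {M N : ℂ → Matrix (Fin n) (Fin n) ℂ}
    (hM : ∀ k l, (fun z => M z k l) ∈ S) (hN : ∀ k l, (fun z => N z k l) ∈ S) (k l : Fin n) :
    (fun z => (M z * N z) k l) ∈ S := by
  simp only [Matrix.mul_apply]
  exact sum_mem_alg S _ _ fun i _ => S.mul_mem (hM _ _) (hN _ _)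

lemma inv_mem_alg (S : Subalgebra ℂ (ℂ → ℂ)) {n : ℕ} {M : ℂ → Matrix (Fin n) (Fin n) ℂ}
    (hM : ∀ k l, (fun z => M z k l) ∈ S) (hd : (fun z => ((M z).det)⁻¹) ∈ S) (k l : Fin n) :
    (fun z => ((M z)⁻¹) k l) ∈ S := by
  simp only [Matrix.inv_def, Ring.inverse_eq_inv', Matrix.smul_apply, smul_eq_mul,
    Matrix.adjugate_apply]
  refine S.mul_mem hd (det_mem_alg S _ fun a b => ?_)
  by_cases h : a = l
  · subst h; simpa using const_mem_alg S _
  · simpa [Matrix.updateRow_ne h] using hM _ _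

lemma disc_inv {n : ℕ} {M : ℂ → Matrix (Fin n) (Fin n) ℂ}
    (hM : ∀ k l, (fun z => M z k l) ∈ DiscAlg) (hu : ∀ z : ℂ, ‖z‖ ≤ 1 → IsUnit (M z)) (k l : Fin n) :
    (fun z => ((M z)⁻¹) k l) ∈ DiscAlg := by
  have hd := det_mem_alg DiscAlg M hM
  have h0 : ∀ z : ℂ, ‖z‖ ≤ 1 → (M z).det ≠ 0 := fun z hz =>
    ((Matrix.isUnit_iff_isUnit_det _).1 (hu z hz)).ne_zero
  refine inv_mem_alg DiscAlg hM ⟨hd.1.inv fun z hz => h0 z ?_, hd.2.inv₀ fun z hz => h0 z ?_⟩ k l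
  · simpa using (mem_ball_zero_iff.1 hz).le
  · simpa using hz

lemma cont_inv {n : ℕ} {M : ℂ → Matrix (Fin n) (Fin n) ℂ}
    (hM : ∀ k l, (fun z => M z k l) ∈ ContAlg) (hu : IsUnit (M 0)) (k l : Fin n) :
    (fun z => ((M z)⁻¹) k l) ∈ ContAlg := by
  have hd := det_mem_alg ContAlg M hM
  exact inv_mem_alg ContAlg hM (ContinuousAt.inv₀ (f := fun z => (M z).det) hd
    ((Matrix.isUnit_iff_isUnit_det _).1 hu).ne_zero) k l

lemma disc_const_of_ball {f : ℂ → ℂ} (hf : f ∈ DiscAlg) (c : ℂ)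
    (h : ∀ z ∈ ball (0 : ℂ) 1, f z = c) : ∀ z ∈ closedBall (0 : ℂ) 1, f z = c := by
  have hcl : closure (ball (0 : ℂ) 1) = closedBall 0 1 := closure_ball 0 one_ne_zero
  have : Set.EqOn f (fun _ => c) (closure (ball (0 : ℂ) 1)) :=
    Set.EqOn.of_subset_closure (s := ball (0 : ℂ) 1) h (by rw [hcl]; exact hf.2)
      continuousOn_const subset_closure le_rfl
  rw [hcl] at this
  exact this

lemma disc_diffCont {f : ℂ → ℂ} (hf : f ∈ DiscAlg) : DiffContOnCl ℂ f (ball 0 1) :=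
  ⟨hf.1, by rw [closure_ball 0 one_ne_zero]; exact hf.2⟩

lemma disc_re_zero {f : ℂ → ℂ} (hf : f ∈ DiscAlg) (h : ∀ z : ℂ, ‖z‖ = 1 → (f z).re = 0) :
    ∀ z ∈ closedBall (0 : ℂ) 1, f z = f 0 := by
  have key : ∀ g : ℂ → ℂ, g ∈ DiscAlg → (∀ z : ℂ, ‖z‖ = 1 → (g z).re = 0) →
      ∀ z ∈ ball (0 : ℂ) 1, ‖Complex.exp (g z)‖ ≤ 1 := by
    intro g hg h z hz
    refine Complex.norm_le_of_forall_mem_frontier_norm_le isBounded_ball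
      (f := fun z => Complex.exp (g z))
      (Complex.differentiable_exp.comp_diffContOnCl (disc_diffCont hg)) ?_ (subset_closure hz)
    intro w hw
    rw [frontier_ball 0 one_ne_zero, mem_sphere_zero_iff_norm] at hw
    simp [Complex.norm_exp, h w hw]
  have hre : ∀ z ∈ ball (0 : ℂ) 1, (f z).re = 0 := by
    intro z hz
    have h1 := key f hf h z hz
    have h2 := key (fun z => - f z) (DiscAlg.neg_mem hf) (by simpa using h) z hz
    simp [Complex.norm_exp] at h1 h2
    linarith
  have h0 : (0 : ℂ) ∈ ball (0 : ℂ) 1 := by simp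
  have hE : DifferentiableOn ℂ (fun z => Complex.exp (f z)) (ball 0 1) := hf.1.cexp
  have hconst : Set.EqOn (fun z => Complex.exp (f z)) (Function.const _ (Complex.exp (f 0)))
      (ball 0 1) := by
    refine Complex.eqOn_of_isPreconnected_of_isMaxOn_norm (convex_ball _ _).isPreconnected
      isOpen_ball hE h0 ?_
    intro z hz
    simp [Complex.norm_exp, hre z hz, hre 0 h0]
  refine disc_const_of_ball hf _ fun z hz => ?_
  refine isOpen_ball.is_const_of_deriv_eq_zero (convex_ball _ _).isPreconnected hf.1 ?_ hz h0
  intro w hw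
  have hd := (hf.1.differentiableAt (isOpen_ball.mem_nhds hw)).hasDerivAt.cexp
  have hev : (fun z => Complex.exp (f z)) =ᶠ[𝓝 w] fun _ => Complex.exp (f 0) :=
    Filter.eventuallyEq_of_mem (isOpen_ball.mem_nhds hw) hconst
  have := hd.unique ((hasDerivAt_const w _).congr_of_eventuallyEq hev)
  simpa [Complex.exp_ne_zero] using this

lemma disc_conj {G : ℂ → ℂ} (hG : G ∈ DiscAlg) :
    (fun z => starRingEnd ℂ (G (starRingEnd ℂ z))) ∈ DiscAlg := by
  constructor
  · intro z hz
    have hz' : starRingEnd ℂ z ∈ ball (0 : ℂ) 1 := by simpa using hz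
    have := (hG.1.differentiableAt (isOpen_ball.mem_nhds hz')).conj_conj
    simpa [Function.comp_def] using this.differentiableWithinAt
  · refine Complex.continuous_conj.comp_continuousOn (hG.2.comp Complex.continuous_conj.continuousOn ?_)
    intro z hz; simpa using hz

lemma disc_rigid {K G : ℂ → ℂ} (hK : K ∈ DiscAlg) (hG : G ∈ DiscAlg)
    (h : ∀ z : ℂ, ‖z‖ = 1 → K z = G z⁻¹) : ∀ w : ℂ, ‖w‖ ≤ 1 → G w = K 0 := by
  have hinv : ∀ z : ℂ, ‖z‖ = 1 → z⁻¹ = starRingEnd ℂ z := fun z hz => by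
    rw [Complex.inv_def, Complex.normSq_eq_norm_sq, hz]; simp
  have hC := disc_conj hG
  set C : ℂ → ℂ := fun z => starRingEnd ℂ (G (starRingEnd ℂ z)) with hCdef
  have e1 := disc_re_zero (f := K - C) (DiscAlg.sub_mem hK hC) (by
    intro z hz; simp [hCdef, h z hz, hinv z hz])
  have e2 := disc_re_zero (f := fun z => Complex.I * (K z + C z))
    (DiscAlg.mul_mem (const_mem_alg _ _) (DiscAlg.add_mem hK hC)) (by
    intro z hz; simp [hCdef, h z hz, hinv z hz])
  have hCc : ∀ z ∈ closedBall (0 : ℂ) 1, K z = K 0 ∧ C z = C 0 := by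
    intro z hz
    have a := e1 z hz
    have b := mul_left_cancel₀ Complex.I_ne_zero (e2 z hz)
    simp only [Pi.sub_apply] at a
    constructor
    · linear_combination (a + b) / 2
    · linear_combination (b - a) / 2
  have hGc : ∀ z : ℂ, ‖z‖ ≤ 1 → G z = G 0 := by
    intro z hz
    have := (hCc (starRingEnd ℂ z) (by simpa using hz)).2
    simpa [hCdef] using congrArg (starRingEnd ℂ) this
  intro w hw
  rw [hGc w hw, ← hGc 1 (by simp), ← (hCc 1 (by simp)).1, h 1 (by simp), inv_one]

lemma disc_tsum {a : ℕ → ℂ} (ha : Summable a) : (fun w => ∑' m, w ^ m * a m) ∈ DiscAlg := by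
  have hb : ∀ m : ℕ, ∀ w ∈ closedBall (0 : ℂ) 1, ‖w ^ m * a m‖ ≤ ‖a m‖ := by
    intro m w hw
    rw [norm_mul, norm_pow]
    have : ‖w‖ ^ m ≤ 1 := pow_le_one₀ (norm_nonneg _) (by simpa using hw)
    nlinarith [norm_nonneg (a m)]
  constructor
  · refine Complex.differentiableOn_tsum_of_summable_norm ha.norm (fun m => ?_) isOpen_ball
      fun m w hw => hb m w (ball_subset_closedBall hw)
    fun_prop
  · exact continuousOn_tsum (fun m => by fun_prop) ha.norm hb

/-- Derivatives of a locally bounded family stay in the disc algebra. -/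
lemma disc_deriv {F : ℂ → ℂ → ℂ} {ρ N : ℝ} (hρ : 0 < ρ)
    (hs : ∀ h : ℂ, ‖h‖ ≤ 1 → DifferentiableOn ℂ (fun s => F s h) (ball 0 ρ))
    (hD : ∀ s ∈ ball (0 : ℂ) ρ, F s ∈ DiscAlg)
    (hN : ∀ s ∈ ball (0 : ℂ) ρ, ∀ h : ℂ, ‖h‖ ≤ 1 → ‖F s h‖ ≤ N) :
    (fun h => deriv (fun s => F s h) 0) ∈ DiscAlg := by
  have h0 : (0 : ℂ) ∈ ball (0 : ℂ) ρ := by simpa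
  have hnh : ball (0 : ℂ) ρ ∈ 𝓝 (0 : ℂ) := isOpen_ball.mem_nhds h0
  have hunif : TendstoUniformlyOn (fun s h => dslope (fun s => F s h) 0 s)
      (fun h => deriv (fun s => F s h) 0) (𝓝[≠] 0) (closedBall (0 : ℂ) 1) := by
    have hest : ∀ h ∈ closedBall (0 : ℂ) 1, ∀ s ∈ ball (0 : ℂ) ρ,
        dist (deriv (fun s => F s h) 0) (dslope (fun s => F s h) 0 s) ≤
          (2 * (2 * N / ρ)) / ρ * ‖s‖ := by
      intro h hh s hsb
      have hh' : ‖h‖ ≤ 1 := by simpa using hh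
      have hb : ∀ z ∈ ball (0 : ℂ) ρ, ‖dslope (fun s => F s h) 0 z‖ ≤ 2 * N / ρ := by
        intro z hz
        refine Complex.norm_dslope_le_div_of_mapsTo_ball (hs h hh') (fun y hy => ?_) hz
        rw [mem_closedBall, dist_eq_norm]
        linarith [norm_sub_le (F y h) (F 0 h), hN y hy h hh', hN 0 h0 h hh']
      have := Complex.dist_le_div_mul_dist_of_mapsTo_ball (f := dslope (fun s => F s h) 0)
        (c := 0) (R₁ := ρ) (R₂ := 2 * (2 * N / ρ)) (z := s)
        ((Complex.differentiableOn_dslope hnh).2 (hs h hh')) (fun y hy => ?_) hsb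
      · rw [dist_comm, ← dslope_same]
        simpa using this
      · rw [mem_closedBall, dist_eq_norm]
        linarith [norm_sub_le (dslope (fun s => F s h) 0 y) (dslope (fun s => F s h) 0 0),
          hb y hy, hb 0 h0]
    rw [Metric.tendstoUniformlyOn_iff]
    intro ε hε
    have ht : Tendsto (fun s : ℂ => (2 * (2 * N / ρ)) / ρ * ‖s‖) (𝓝[≠] 0) (𝓝 0) := by
      have : Continuous (fun s : ℂ => (2 * (2 * N / ρ)) / ρ * ‖s‖) := by fun_prop
      have := this.tendsto 0
      simp only [norm_zero, mul_zero] at this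
      exact this.mono_left nhdsWithin_le_nhds
    filter_upwards [ht.eventually (gt_mem_nhds hε), nhdsWithin_le_nhds hnh] with s h1 h2 h hh
    exact (hest h hh s h2).trans_lt h1
  have hmem : ∀ᶠ s in 𝓝[≠] (0 : ℂ), (fun h => dslope (fun s => F s h) 0 s) ∈ DiscAlg := by
    filter_upwards [nhdsWithin_le_nhds hnh, self_mem_nhdsWithin] with s h1 h2
    have : (fun h => dslope (fun s => F s h) 0 s) = fun h => s⁻¹ * (F s h - F 0 h) := by
      ext h
      rw [dslope_of_ne _ h2, slope_def_module]
      simp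
    rw [this]
    exact DiscAlg.mul_mem (const_mem_alg _ _) (DiscAlg.sub_mem (hD s h1) (hD 0 h0))
  constructor
  · exact (hunif.mono ball_subset_closedBall).tendstoLocallyUniformlyOn.differentiableOn
      (hmem.mono fun s h => h.1) isOpen_ball
  · exact hunif.continuousOn (hmem.frequently.mono fun s h => h.2)

/-- Baire argument: a separately continuous family is locally bounded near a point close to `0`. -/
lemma baire_bound {n : ℕ} {F : ℂ → ℂ → Matrix (Fin n) (Fin n) ℂ} {ε : ℝ} (hε : 0 < ε)
    (hs : ∀ h : ℂ, ‖h‖ ≤ 1 → ∀ k l, ContinuousOn (fun s => F s h k l) (ball 0 ε))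
    (hD : ∀ s ∈ ball (0 : ℂ) ε, ∀ k l, (fun h => F s h k l) ∈ DiscAlg) :
    ∃ s₀ ∈ ball (0 : ℂ) ε, ∃ ρ > 0, ∃ N : ℝ, ∀ s ∈ ball s₀ ρ, s ∈ ball (0 : ℂ) ε ∧
      ∀ h : ℂ, ‖h‖ ≤ 1 → ∀ k l, ‖F s h k l‖ ≤ N := by
  let f : ℕ → Set ℂ := fun N =>
    {s | s ∈ ball (0 : ℂ) ε → ∀ h : ℂ, ‖h‖ ≤ 1 → ∀ k l, ‖F s h k l‖ ≤ N}
  have hcl : ∀ N, IsClosed (f N) := by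
    intro N
    rw [← isOpen_compl_iff]
    have : (f N)ᶜ = ⋃ h : {h : ℂ // ‖h‖ ≤ 1}, ⋃ k, ⋃ l,
        (ball (0 : ℂ) ε ∩ (fun s => F s h k l) ⁻¹' (closedBall 0 (N : ℝ))ᶜ) := by
      ext s
      simp only [f, Set.mem_compl_iff, Set.mem_ofPred_eq, Set.mem_iUnion, Set.mem_inter_iff,
        Set.mem_preimage, mem_closedBall, dist_zero_right]
      push Not
      constructor
      · rintro ⟨a, h, hh, k, l, b⟩
        exact ⟨⟨h, hh⟩, k, l, a, b⟩
      · rintro ⟨⟨h, hh⟩, k, l, a, b⟩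
        exact ⟨a, h, hh, k, l, b⟩
    rw [this]
    refine isOpen_iUnion fun h => isOpen_iUnion fun k => isOpen_iUnion fun l => ?_
    exact (hs h h.2 k l).isOpen_inter_preimage isOpen_ball isClosed_closedBall.isOpen_compl
  have hU : ⋃ N, f N = Set.univ := by
    refine Set.eq_univ_of_forall fun s => ?_
    by_cases hsb : s ∈ ball (0 : ℂ) ε
    · have : ∀ k l, ∃ C : ℝ, ∀ h ∈ closedBall (0 : ℂ) 1, ‖F s h k l‖ ≤ C := fun k l =>
        (isCompact_closedBall (0 : ℂ) 1).exists_bound_of_continuousOn (hD s hsb k l).2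
      choose C hC using this
      have hC0 : ∀ k l, 0 ≤ C k l := fun k l => (norm_nonneg _).trans (hC k l 0 (by simp))
      obtain ⟨N, hN⟩ := exists_nat_ge (∑ k, ∑ l, C k l)
      refine Set.mem_iUnion.2 ⟨N, fun _ h hh k l => ?_⟩
      refine (hC k l h (by simpa using hh)).trans (le_trans ?_ hN)
      refine le_trans ?_ (Finset.single_le_sum (f := fun k => ∑ l, C k l)
        (fun k _ => Finset.sum_nonneg fun l _ => hC0 k l) (Finset.mem_univ k))
      exact Finset.single_le_sum (f := fun l => C k l) (fun l _ => hC0 k l) (Finset.mem_univ l)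
    · exact Set.mem_iUnion.2 ⟨0, fun h => absurd h hsb⟩
  obtain ⟨s₀, hs₀, hs₁⟩ := (dense_iUnion_interior_of_closed hcl hU).inter_open_nonempty
    (ball (0 : ℂ) ε) isOpen_ball ⟨0, by simpa⟩
  obtain ⟨N, hN⟩ := Set.mem_iUnion.1 hs₁
  obtain ⟨ρ, hρ, hsub⟩ := Metric.isOpen_iff.1 (isOpen_interior.inter isOpen_ball) s₀ ⟨hN, hs₀⟩
  exact ⟨s₀, hs₀, ρ, hρ, N, fun s hs' => ⟨(hsub hs').2,
    interior_subset (hsub hs').1 (hsub hs').2⟩⟩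

lemma hasDerivAt_slice {r : ℕ} {U : Set (Fin r → ℂ)} (hU : IsOpen U) {f : (Fin r → ℂ) → ℂ}
    (hf : DifferentiableOn ℂ f U) {t : Fin r → ℂ} (e : Fin r → ℂ) {s : ℂ} (ht : t + s • e ∈ U) :
    HasDerivAt (fun s : ℂ => f (t + s • e)) (fderiv ℂ f (t + s • e) e) s := by
  have h1 := (hf.differentiableAt (hU.mem_nhds ht)).hasFDerivAt
  have h2 : HasDerivAt (fun s : ℂ => t + s • e) e s := by
    simpa using ((hasDerivAt_id s).smul_const e).const_add t
  exact h1.comp_hasDerivAt s h2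

lemma omega_formula {p : ℕ} {ζ : ℂ} (hζ : IsPrimitiveRoot ζ (p + 2)) (w : ℂ) (c : ℕ → ℂ) :
    w = ((p + 2 : ℕ) : ℂ)⁻¹ * ∑ a ∈ Finset.range (p + 2),
      ζ ^ a * ((ζ ^ a)⁻¹ * w + ∑ j ∈ Finset.range (p + 1), (ζ ^ a) ^ j * c j) := by
  have hζ0 : ζ ≠ 0 := hζ.ne_zero (by omega)
  have hz : ∀ j ∈ Finset.range (p + 1), ∑ a ∈ Finset.range (p + 2), (ζ ^ (j + 1)) ^ a = 0 := by
    intro j hj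
    have hj' := Finset.mem_range.1 hj
    have h1 : ζ ^ (j + 1) - 1 ≠ 0 := sub_ne_zero.2
      (hζ.pow_ne_one_of_pos_of_lt (by omega) (by omega))
    have h2 := mul_geom_sum (ζ ^ (j + 1)) (p + 2)
    rw [← pow_mul, mul_comm (j + 1), pow_mul, hζ.pow_eq_one, one_pow, sub_self] at h2
    exact (mul_eq_zero.1 h2).resolve_left h1
  have : ∑ a ∈ Finset.range (p + 2),
      ζ ^ a * ((ζ ^ a)⁻¹ * w + ∑ j ∈ Finset.range (p + 1), (ζ ^ a) ^ j * c j)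
      = ((p + 2 : ℕ) : ℂ) * w + ∑ j ∈ Finset.range (p + 1),
        (∑ a ∈ Finset.range (p + 2), (ζ ^ (j + 1)) ^ a) * c j := by
    simp only [mul_add, Finset.sum_add_distrib, Finset.mul_sum, Finset.sum_mul]
    congr 1
    · simp [hζ0]
    · rw [Finset.sum_comm]
      refine Finset.sum_congr rfl fun j _ => Finset.sum_congr rfl fun a _ => ?_
      rw [← pow_mul, ← pow_mul]; ring
  rw [this, Finset.sum_congr rfl fun j hj => by rw [hz j hj, zero_mul]]
  have : ((p + 2 : ℕ) : ℂ) ≠ 0 := by exact_mod_cast (by omega : p + 2 ≠ 0)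
  simp only [Finset.sum_const_zero, add_zero]
  field_simp

/-- The analytic heart: everything at one fixed `t`. -/
lemma birkhoff_core {n p : ℕ} (Lm Lp dLm dLp : ℂ → Matrix (Fin n) (Fin n) ℂ)
    (A dA : ℕ → Matrix (Fin n) (Fin n) ℂ)
    (ω : Matrix (Fin n) (Fin n) ℂ) (θ : ℕ → Matrix (Fin n) (Fin n) ℂ)
    (hΩ : ∀ h : ℂ, ‖h‖ = 1 → (Lm h * Lp h)⁻¹ * (dLm h * Lp h + Lm h * dLp h)
        = h⁻¹ • ω + ∑ j ∈ Finset.range (p+1), (h ^ j : ℂ) • θ j)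
    (hLm : ∀ h : ℂ, 1 ≤ ‖h‖ → ∀ k l, HasSum (fun m : ℕ => (h⁻¹) ^ (m+1) * A m k l)
        (Lm h k l - (1 : Matrix (Fin n) (Fin n) ℂ) k l))
    (hLmd : ∀ h : ℂ, 1 ≤ ‖h‖ → ∀ k l,
      HasSum (fun m : ℕ => (h⁻¹) ^ (m+1) * dA m k l) (dLm h k l))
    (hLmu : ∀ h : ℂ, 1 ≤ ‖h‖ → IsUnit (Lm h))
    (hLp : ∀ k l, (fun h => Lp h k l) ∈ DiscAlg)
    (hdLp : ∀ k l, (fun h => dLp h k l) ∈ DiscAlg)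
    (hLpu : ∀ h : ℂ, ‖h‖ ≤ 1 → IsUnit (Lp h)) (h : ℂ) (hh : 1 ≤ ‖h‖) :
    (Lm h)⁻¹ * dLm h = h⁻¹ • (Lp 0 * ω * (Lp 0)⁻¹) := by
  have hid : (fun z : ℂ => z) ∈ DiscAlg := ⟨differentiableOn_id, continuousOn_id⟩
  let M : ℂ → Matrix (Fin n) (Fin n) ℂ := fun w => Matrix.of fun k l =>
    (1 : Matrix (Fin n) (Fin n) ℂ) k l + w * ∑' m, w ^ m * A m k l
  let E : ℂ → Matrix (Fin n) (Fin n) ℂ := fun w => Matrix.of fun k l => ∑' m, w ^ m * dA m k l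
  have hM : ∀ h : ℂ, 1 ≤ ‖h‖ → M h⁻¹ = Lm h := by
    intro h hh
    ext k l
    have := (hLm h hh k l).tsum_eq
    simp only [pow_succ', mul_assoc, tsum_mul_left] at this
    simp only [M, Matrix.of_apply]
    rw [this]; ring
  have hE : ∀ h : ℂ, 1 ≤ ‖h‖ → h⁻¹ • E h⁻¹ = dLm h := by
    intro h hh
    ext k l
    have := (hLmd h hh k l).tsum_eq
    simp only [pow_succ', mul_assoc, tsum_mul_left] at this
    simp only [E, Matrix.smul_apply, Matrix.of_apply, smul_eq_mul]
    exact this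
  have hMu : ∀ w : ℂ, ‖w‖ ≤ 1 → IsUnit (M w) := by
    intro w hw
    by_cases h0 : w = 0
    · have : M w = 1 := by ext k l; simp [M, h0]
      rw [this]; exact isUnit_one
    · have h1 : 1 ≤ ‖w⁻¹‖ := by
        rw [norm_inv]; exact (one_le_inv₀ (norm_pos_iff.2 h0)).2 hw
      have := hM w⁻¹ h1
      rw [inv_inv] at this
      rw [this]; exact hLmu _ h1
  have hMd : ∀ k l, (fun w => M w k l) ∈ DiscAlg := by
    intro k l
    refine DiscAlg.add_mem (const_mem_alg _ _) (DiscAlg.mul_mem hid (disc_tsum ?_))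
    simpa using (hLm 1 (by simp) k l).summable
  have hEd : ∀ k l, (fun w => E w k l) ∈ DiscAlg := by
    intro k l
    refine disc_tsum ?_
    simpa using (hLmd 1 (by simp) k l).summable
  let P : ℂ → Matrix (Fin n) (Fin n) ℂ := fun h =>
    ω + ∑ j ∈ Finset.range (p+1), (h ^ (j + 1) : ℂ) • θ j
  have hP : ∀ k l, (fun w => P w k l) ∈ DiscAlg := by
    intro k l
    have : (fun w => P w k l) = fun w => ω k l + ∑ j ∈ Finset.range (p+1), w ^ (j + 1) * θ j k l := by
      ext w; simp [P, Matrix.sum_apply]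
    rw [this]
    exact DiscAlg.add_mem (const_mem_alg _ _) (sum_mem_alg _ _ _ fun j _ =>
      DiscAlg.mul_mem (DiscAlg.pow_mem hid _) (const_mem_alg _ _))
  have hLpi := disc_inv hLp hLpu
  have hMi := disc_inv hMd hMu
  have hG := mul_mem_alg DiscAlg hMi hEd
  have hK1 := mul_mem_alg DiscAlg (mul_mem_alg DiscAlg hLp hP) hLpi
  have hK2 := mul_mem_alg DiscAlg hdLp hLpi
  have hGE : ∀ h : ℂ, 1 ≤ ‖h‖ → (Lm h)⁻¹ * dLm h = h⁻¹ • ((M h⁻¹)⁻¹ * E h⁻¹) := by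
    intro h hh
    rw [hM h hh, ← hE h hh, Matrix.mul_smul]
  have hcirc : ∀ h : ℂ, ‖h‖ = 1 →
      Lp h * P h * (Lp h)⁻¹ - h • (dLp h * (Lp h)⁻¹) = (M h⁻¹)⁻¹ * E h⁻¹ := by
    intro h hh
    have h0 : h ≠ 0 := by rintro rfl; simp at hh
    have e1 := hGE h hh.ge
    have uM := (Matrix.isUnit_iff_isUnit_det _).1 (hLmu h hh.ge)
    have uP := (Matrix.isUnit_iff_isUnit_det _).1 (hLpu h hh.le)
    have e2 : (M h⁻¹)⁻¹ * E h⁻¹ = h • ((Lm h)⁻¹ * dLm h) := by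
      rw [e1, smul_smul, mul_inv_cancel₀ h0, one_smul]
    have e3 : P h = h • (h⁻¹ • ω + ∑ j ∈ Finset.range (p+1), (h ^ j : ℂ) • θ j) := by
      simp only [P, smul_add, smul_smul, mul_inv_cancel₀ h0, one_smul, Finset.smul_sum, pow_succ']
    rw [e2, e3, ← hΩ h hh, Matrix.mul_inv_rev]
    have e4 : Lp h * ((Lp h)⁻¹ * (Lm h)⁻¹ * (dLm h * Lp h + Lm h * dLp h)) * (Lp h)⁻¹
        = (Lm h)⁻¹ * dLm h + dLp h * (Lp h)⁻¹ := by
      have a1 : Lp h * (Lp h)⁻¹ = 1 := Matrix.mul_nonsing_inv _ uP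
      have a2 : (Lm h)⁻¹ * Lm h = 1 := Matrix.nonsing_inv_mul _ uM
      calc _ = (Lp h * (Lp h)⁻¹) * ((Lm h)⁻¹ * dLm h) * (Lp h * (Lp h)⁻¹)
            + (Lp h * (Lp h)⁻¹) * ((Lm h)⁻¹ * Lm h) * (dLp h * (Lp h)⁻¹) := by noncomm_ring
        _ = _ := by rw [a1, a2]; simp
    rw [Matrix.mul_smul, Matrix.smul_mul, e4, smul_add, add_sub_cancel_right]
  rw [hGE h hh]
  congr 1
  ext k l
  have := disc_rigid (K := fun h => (Lp h * P h * (Lp h)⁻¹) k l - h * (dLp h * (Lp h)⁻¹) k l)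
    (G := fun w => ((M w)⁻¹ * E w) k l)
    (DiscAlg.sub_mem (hK1 k l) (DiscAlg.mul_mem hid (hK2 k l))) (hG k l)
    (fun z hz => by simpa using congrFun (congrFun (hcirc z hz) k) l) h⁻¹
    (by rw [norm_inv]; exact inv_le_one_of_one_le₀ hh)
  rw [this]
  simp [P]

/-- Proposition 3.2: if L⁻¹dL = (1/h)ω + θ⁽⁰⁾ + hθ⁽¹⁾ + ⋯ + h^pθ⁽ᵖ⁾ on the
circle |h| = 1, and L = L₋L₊ is a Birkhoff factorization with
L₋ = I + h⁻¹A₁ + h⁻²A₂ + ⋯ holomorphic for |h| > 1 with L₋(∞) = I, and L₊ holomorphic on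
|h| < 1 with L₊(0) = Q₀, then L₋⁻¹dL₋ = (1/h) Q₀ ω Q₀⁻¹; in particular only the h⁻¹
coefficient of L₋⁻¹dL₋ is nonzero. -/
theorem stmt4 {r n p : ℕ} (U : Set (Fin r → ℂ)) (hU : IsOpen U)
    (L Lm Lp : (Fin r → ℂ) → ℂ → Matrix (Fin n) (Fin n) ℂ)
    (ω : Fin r → (Fin r → ℂ) → Matrix (Fin n) (Fin n) ℂ)
    (θ : ℕ → Fin r → (Fin r → ℂ) → Matrix (Fin n) (Fin n) ℂ)
    (A : ℕ → (Fin r → ℂ) → Matrix (Fin n) (Fin n) ℂ)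
    (hLdiff : ∀ h : ℂ, ‖h‖ = 1 → ∀ k l, DifferentiableOn ℂ (fun t => L t h k l) U)
    (hLu : ∀ t ∈ U, ∀ h : ℂ, ‖h‖ = 1 → IsUnit (L t h))
    (hΩ : ∀ t ∈ U, ∀ i, ∀ h : ℂ, ‖h‖ = 1 →
      (L t h)⁻¹ * pdh L i t h
        = h⁻¹ • ω i t + ∑ j ∈ Finset.range (p+1), (h ^ j : ℂ) • θ j i t)
    (hfact : ∀ t ∈ U, ∀ h : ℂ, ‖h‖ = 1 → L t h = Lm t h * Lp t h)
    (hAdiff : ∀ m k l, DifferentiableOn ℂ (fun t => A m t k l) U)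
    (hLmdiff : ∀ h : ℂ, 1 ≤ ‖h‖ → ∀ k l, DifferentiableOn ℂ (fun t => Lm t h k l) U)
    (hLm : ∀ t ∈ U, ∀ h : ℂ, 1 ≤ ‖h‖ → ∀ k l,
      HasSum (fun m : ℕ => (h⁻¹) ^ (m+1) * A m t k l)
        (Lm t h k l - (1 : Matrix (Fin n) (Fin n) ℂ) k l))
    (hLmd : ∀ t ∈ U, ∀ i, ∀ h : ℂ, 1 ≤ ‖h‖ → ∀ k l,
      HasSum (fun m : ℕ => (h⁻¹) ^ (m+1) * pdm (A m) i t k l) (pdh Lm i t h k l))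
    (hLmu : ∀ t ∈ U, ∀ h : ℂ, 1 ≤ ‖h‖ → IsUnit (Lm t h))
    (hLphol : ∀ t ∈ U, ∀ k l,
      DifferentiableOn ℂ (fun h => Lp t h k l) (Metric.closedBall (0 : ℂ) 1))
    (hLpdiff : ∀ h : ℂ, ‖h‖ ≤ 1 → ∀ k l, DifferentiableOn ℂ (fun t => Lp t h k l) U)
    (hLpu : ∀ t ∈ U, ∀ h : ℂ, ‖h‖ ≤ 1 → IsUnit (Lp t h)) :
    ∀ t ∈ U, ∀ i, ∀ h : ℂ, 1 ≤ ‖h‖ →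
      (Lm t h)⁻¹ * pdh Lm i t h = h⁻¹ • (Lp t 0 * ω i t * (Lp t 0)⁻¹) := by
  have hLpD : ∀ t ∈ U, ∀ k l, (fun h => Lp t h k l) ∈ DiscAlg := fun t ht k l =>
    ⟨(hLphol t ht k l).mono ball_subset_closedBall, (hLphol t ht k l).continuousOn⟩
  -- the result at points around which `Lp` is bounded along the slice
  have core : ∀ t ∈ U, ∀ i, ∀ ρ > 0, ∀ N : ℝ, (∀ s ∈ ball (0 : ℂ) ρ,
      t + s • (Pi.single i 1 : Fin r → ℂ) ∈ U ∧ ∀ h : ℂ, ‖h‖ ≤ 1 → ∀ k l,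
        ‖Lp (t + s • (Pi.single i 1 : Fin r → ℂ)) h k l‖ ≤ N) → ∀ h : ℂ, 1 ≤ ‖h‖ →
      (Lm t h)⁻¹ * pdh Lm i t h = h⁻¹ • (Lp t 0 * ω i t * (Lp t 0)⁻¹) := by
    intro t ht i ρ hρ N hb
    have ht0 : t + (0 : ℂ) • (Pi.single i 1 : Fin r → ℂ) ∈ U := by simpa using ht
    refine birkhoff_core (p := p) (Lm t) (Lp t) (pdh Lm i t) (pdh Lp i t) (fun m => A m t)
      (fun m => pdm (A m) i t) (ω i t) (fun j => θ j i t) ?_ (hLm t ht) (hLmd t ht i) (hLmu t ht)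
      (hLpD t ht) ?_ (hLpu t ht)
    · intro h hh
      rw [← hΩ t ht i h hh, hfact t ht h hh]
      congr 1
      ext k l
      have e1 : (fun x => L x h k l) =ᶠ[𝓝 t] fun x => ∑ j, Lm x h k j * Lp x h j l := by
        filter_upwards [hU.mem_nhds ht] with x hx
        rw [hfact x hx h hh, Matrix.mul_apply]
      have hm : ∀ k l, DifferentiableAt ℂ (fun x => Lm x h k l) t := fun k l =>
        (hLmdiff h hh.ge k l).differentiableAt (hU.mem_nhds ht)
      have hp : ∀ k l, DifferentiableAt ℂ (fun x => Lp x h k l) t := fun k l =>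
        (hLpdiff h hh.le k l).differentiableAt (hU.mem_nhds ht)
      have e2 : HasFDerivAt (fun x => ∑ j, Lm x h k j * Lp x h j l) _ t :=
        HasFDerivAt.fun_sum fun j _ => (hm k j).hasFDerivAt.mul (hp j l).hasFDerivAt
      simp only [pdh, Matrix.of_apply, Matrix.add_apply, Matrix.mul_apply]
      rw [e1.fderiv_eq, e2.fderiv, ← Finset.sum_add_distrib]
      simp only [sum_apply, add_apply,
        smul_apply, smul_eq_mul]
      exact Finset.sum_congr rfl fun j _ => by ring
    · intro k l
      have hd := disc_deriv (F := fun s h => Lp (t + s • (Pi.single i 1 : Fin r → ℂ)) h k l)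
        (N := N) hρ
        (fun h hh s hs => (hasDerivAt_slice hU (hLpdiff h hh k l) _
          (hb s hs).1).differentiableAt.differentiableWithinAt)
        (fun s hs => hLpD _ (hb s hs).1 k l) (fun s hs h hh => (hb s hs).2 h hh k l)
      have heq : ∀ h : ℂ, ‖h‖ ≤ 1 → pdh Lp i t h k l =
          deriv (fun s : ℂ => Lp (t + s • (Pi.single i 1 : Fin r → ℂ)) h k l) 0 := by
        intro h hh
        rw [(hasDerivAt_slice hU (hLpdiff h hh k l) _ ht0).deriv]
        simp [pdh]
      exact ⟨hd.1.congr fun h hh => heq h (by simpa using (mem_ball_zero_iff.1 hh).le),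
        hd.2.congr fun h hh => heq h (by simpa using hh)⟩
  intro t ht i h hh
  set e : Fin r → ℂ := Pi.single i 1 with he
  have hcont : Continuous fun s : ℂ => t + s • e := by fun_prop
  have hmem : ∀ᶠ s in 𝓝 (0 : ℂ), t + s • e ∈ U :=
    hcont.continuousAt.eventually (hU.mem_nhds (by simpa using ht))
  obtain ⟨ε, hε, hεU⟩ := Metric.eventually_nhds_iff_ball.1 hmem
  have ht0 : t + (0 : ℂ) • e ∈ U := by simpa using ht
  have c0 : ∀ f : (Fin r → ℂ) → ℂ, DifferentiableOn ℂ f U →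
      (fun s : ℂ => f (t + s • e)) ∈ ContAlg := fun f hf =>
    (hasDerivAt_slice hU hf e ht0).continuousAt
  have c1 : ∀ f : (Fin r → ℂ) → ℂ, DifferentiableOn ℂ f U →
      (fun s : ℂ => fderiv ℂ f (t + s • e) e) ∈ ContAlg := by
    intro f hf
    have hd : DifferentiableOn ℂ (fun s : ℂ => f (t + s • e)) (ball 0 ε) := fun s hs =>
      (hasDerivAt_slice hU hf e (hεU s hs)).differentiableAt.differentiableWithinAt
    have hb : ball (0 : ℂ) ε ∈ 𝓝 (0 : ℂ) := ball_mem_nhds _ hε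
    have h2 : ContinuousAt (deriv fun s : ℂ => f (t + s • e)) 0 :=
      ((hd.deriv isOpen_ball).differentiableAt hb).continuousAt
    show ContinuousAt (fun s : ℂ => fderiv ℂ f (t + s • e) e) 0
    refine h2.congr ?_
    filter_upwards [hb] with s hs
    exact (hasDerivAt_slice hU hf e (hεU s hs)).deriv
  have cω : ∀ k l, (fun s : ℂ => ω i (t + s • e) k l) ∈ ContAlg := by
    intro k l
    obtain ⟨ζ, hζ⟩ : ∃ ζ : ℂ, IsPrimitiveRoot ζ (p + 2) :=
      ⟨_, Complex.isPrimitiveRoot_exp (p + 2) (by omega)⟩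
    have hn : ∀ a : ℕ, ‖ζ ^ a‖ = 1 := fun a => by
      rw [norm_pow, hζ.norm'_eq_one (by omega), one_pow]
    have hc : (fun s : ℂ => ((p + 2 : ℕ) : ℂ)⁻¹ * ∑ a ∈ Finset.range (p + 2),
        ζ ^ a * ((L (t + s • e) (ζ ^ a))⁻¹ * pdh L i (t + s • e) (ζ ^ a)) k l) ∈ ContAlg := by
      refine ContAlg.mul_mem (const_mem_alg _ _) (sum_mem_alg _ _ _ fun a _ =>
        ContAlg.mul_mem (const_mem_alg _ _) (mul_mem_alg ContAlg (cont_inv (fun k l =>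
          c0 (fun x => L x (ζ ^ a) k l) (hLdiff _ (hn a) k l)) (hLu _ ht0 _ (hn a)))
          (fun k l => c1 (fun x => L x (ζ ^ a) k l) (hLdiff _ (hn a) k l)) k l))
    show ContinuousAt (fun s : ℂ => ω i (t + s • e) k l) 0
    refine ContinuousAt.congr (f := fun s : ℂ => ((p + 2 : ℕ) : ℂ)⁻¹ * ∑ a ∈ Finset.range (p + 2),
        ζ ^ a * ((L (t + s • e) (ζ ^ a))⁻¹ * pdh L i (t + s • e) (ζ ^ a)) k l) hc ?_
    filter_upwards [hmem] with s hs
    refine Eq.trans ?_ (omega_formula hζ (ω i (t + s • e) k l)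
      (fun j => θ j i (t + s • e) k l)).symm
    congr 1
    refine Finset.sum_congr rfl fun a _ => ?_
    rw [hΩ _ hs i _ (hn a)]
    simp [Matrix.sum_apply]
  have cLeft := mul_mem_alg ContAlg (cont_inv (fun k l =>
      c0 (fun x => Lm x h k l) (hLmdiff h hh k l)) (hLmu _ ht0 h hh))
    (N := fun s => pdh Lm i (t + s • e) h) (fun k l => c1 (fun x => Lm x h k l) (hLmdiff h hh k l))
  have hn0 : ‖(0 : ℂ)‖ ≤ 1 := by simp
  have cQ := fun k l => c0 (fun x => Lp x 0 k l) (hLpdiff 0 hn0 k l)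
  have cRight := mul_mem_alg ContAlg (mul_mem_alg ContAlg cQ cω)
    (cont_inv cQ (hLpu _ ht0 0 hn0))
  have hfreq : ∃ᶠ s in 𝓝 (0 : ℂ), (Lm (t + s • e) h)⁻¹ * pdh Lm i (t + s • e) h =
      h⁻¹ • (Lp (t + s • e) 0 * ω i (t + s • e) * (Lp (t + s • e) 0)⁻¹) := by
    rw [Metric.nhds_basis_ball.frequently_iff]
    intro δ hδ
    have hsub : ∀ s ∈ ball (0 : ℂ) (min δ ε), t + s • e ∈ U := fun s hs =>
      hεU s (ball_subset_ball (min_le_right _ _) hs)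
    obtain ⟨s₀, hs₀, ρ, hρ, N, hN⟩ := baire_bound (F := fun s h => Lp (t + s • e) h)
      (lt_min hδ hε)
      (fun h hh k l s hs => (hasDerivAt_slice hU (hLpdiff h hh k l) e
        (hsub s hs)).continuousAt.continuousWithinAt)
      (fun s hs k l => hLpD _ (hsub s hs) k l)
    refine ⟨s₀, ball_subset_ball (min_le_left _ _) hs₀, ?_⟩
    refine core _ (hsub s₀ hs₀) i ρ hρ N (fun s hs => ?_) h hh
    have hs' : s₀ + s ∈ ball s₀ ρ := by simpa [dist_eq_norm] using hs
    rw [add_assoc, ← add_smul]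
    exact ⟨hsub _ (hN _ hs').1, (hN _ hs').2⟩
  ext k l
  have := tendsto_nhds_unique_of_frequently_eq (cLeft k l)
    (ContAlg.mul_mem (const_mem_alg _ h⁻¹) (cRight k l)) (hfreq.mono fun s hs => by
      simpa using congrFun (congrFun hs k) l)
  simpa using this
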